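/- arXiv:1512.02171 — 5 statements merged into one kernel-verified Lean document; each statement's English description precedes it below -/
import Mathlib

section
/- Every permutation obtained from the identity permutation by applying a sequence of p right-jumps has at most p non-left-to-right-maxima. -/
/-- The word `σ₁σ₂…σₙ` of a permutation of `{1,…,n}` (0-indexed). -/
def permWord {n : ℕ} (σ : Equiv.Perm (Fin n)) : List (Fin n) :=
  List.ofFn (fun i => σ i)

/-- `β` is obtained from `α` by one right-jump: one entry is removed and
reinserted at a strictly later position. -/
def RightJump {n : ℕ} (α β : Equiv.Perm (Fin n)) : Prop :=
  ∃ (l₁ l₂ l₃ : List (Fin n)) (a : Fin n), l₂ ≠ [] ∧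
    permWord α = l₁ ++ a :: (l₂ ++ l₃) ∧
    permWord β = l₁ ++ (l₂ ++ a :: l₃)

/-- `ReachIn p α β` : `β` is obtained from `α` by a sequence of exactly `p` right-jumps. -/
def ReachIn {n : ℕ} : ℕ → Equiv.Perm (Fin n) → Equiv.Perm (Fin n) → Prop
  | 0, α, β => α = β
  | p + 1, α, β => ∃ γ, RightJump α γ ∧ ReachIn p γ β

/-- `σᵢ` is a left-to-right maximum of `σ`. -/
def IsLtrMax {n : ℕ} (σ : Equiv.Perm (Fin n)) (i : Fin n) : Prop :=
  ∀ j, j ≤ i → σ j ≤ σ i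

/-- The number of non-left-to-right-maxima of `σ`. -/
noncomputable def nonLtrMaxCount {n : ℕ} (σ : Equiv.Perm (Fin n)) : ℕ :=
  {i : Fin n | ¬ IsLtrMax σ i}.ncard

theorem isLtrMax_iff_pw {n : ℕ} (σ : Equiv.Perm (Fin n)) (i : Fin n) :
    IsLtrMax σ i ↔ (permWord σ).Pairwise (fun x y => y = σ i → x ≤ y) := by
  unfold IsLtrMax permWord
  rw [List.pairwise_ofFn]
  constructor
  · intro h j k hjk hk
    have := σ.injective hk
    subst this
    exact h j hjk.le
  · intro h j hj
    rcases hj.lt_or_eq with h1 | h1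
    · exact h h1 rfl
    · rw [h1]

theorem nonLtrMaxCount_eq_values {n : ℕ} (σ : Equiv.Perm (Fin n)) :
    nonLtrMaxCount σ =
      {v : Fin n | ¬ (permWord σ).Pairwise (fun x y => y = v → x ≤ y)}.ncard := by
  unfold nonLtrMaxCount
  rw [← Set.ncard_image_of_injective _ σ.injective]
  congr 1
  ext v
  simp only [Set.mem_image, Set.mem_setOf_eq, isLtrMax_iff_pw]
  constructor
  · rintro ⟨i, hi, rfl⟩
    exact hi
  · intro h
    exact ⟨σ.symm v, by simpa using h, by simp⟩

theorem nonLtrMaxCount_rightJump {n : ℕ} {α β : Equiv.Perm (Fin n)} (h : RightJump α β) :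
    nonLtrMaxCount β ≤ nonLtrMaxCount α + 1 := by
  obtain ⟨l₁, l₂, l₃, a, -, hα, hβ⟩ := h
  rw [nonLtrMaxCount_eq_values, nonLtrMaxCount_eq_values, hα, hβ]
  refine le_trans (Set.ncard_le_ncard ?_ (Set.toFinite _)) (Set.ncard_insert_le a _)
  intro v hv
  by_cases hva : v = a
  · exact Or.inl hva
  · right
    intro hp
    apply hv
    simp only [List.pairwise_append, List.pairwise_cons, List.mem_append, List.mem_cons] at hp ⊢
    grind

theorem nonLtrMaxCount_reachIn_gen {n : ℕ} (p : ℕ) : ∀ (α σ : Equiv.Perm (Fin n)),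
    ReachIn p α σ → nonLtrMaxCount σ ≤ nonLtrMaxCount α + p := by
  induction p with
  | zero =>
    intro α σ h
    have h' : α = σ := h
    rw [h']; simp
  | succ p ih =>
    intro α σ h
    obtain ⟨γ, h1, h2⟩ := h
    have := ih γ σ h2
    have := nonLtrMaxCount_rightJump h1
    omega

/-- Every permutation obtained from the identity permutation by applying a
sequence of `p` right-jumps has at most `p` non-left-to-right-maxima. -/
theorem nonLtrMaxCount_le_of_reachIn (n p : ℕ) (σ : Equiv.Perm (Fin n))
    (h : ReachIn p 1 σ) : nonLtrMaxCount σ ≤ p := by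
  have h1 := nonLtrMaxCount_reachIn_gen p 1 σ h
  have h0 : nonLtrMaxCount (1 : Equiv.Perm (Fin n)) = 0 := by
    unfold nonLtrMaxCount IsLtrMax
    simp
  omega
end

section
/- For all integers n ≥ 1 and 0 ≤ p ≤ n−1, the number of permutations of length n having exactly p non-left-to-right-maxima (equivalently, exactly n−p left-to-right maxima) equals the signless Stirling number of the first kind s(n, n−p), given by the closed-form double sum Σ_{0 ≤ j ≤ h ≤ p} (−1)^j · C(h,j) · C(n−1+h, p+h) · C(n+p, p−h) · (j−h)^{p+h} / h!. -/
/-- The signless Stirling numbers of the first kind,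
`s(n+1,k) = n·s(n,k) + s(n,k−1)`, `s(0,0) = 1`. -/
def stirling1 : ℕ → ℕ → ℕ
  | 0, 0 => 1
  | 0, _ + 1 => 0
  | _ + 1, 0 => 0
  | n + 1, k + 1 => n * stirling1 n (k + 1) + stirling1 n k

def insLast {n : ℕ} (x : Fin (n+1) × Equiv.Perm (Fin n)) : Equiv.Perm (Fin (n+1)) :=
  (finSuccEquiv' (Fin.last n)).trans ((Equiv.optionCongr x.2).trans (finSuccEquiv' x.1).symm)

theorem insLast_last {n : ℕ} (x : Fin (n+1) × Equiv.Perm (Fin n)) :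
    insLast x (Fin.last n) = x.1 := by
  simp [insLast]

theorem insLast_castSucc {n : ℕ} (x : Fin (n+1) × Equiv.Perm (Fin n)) (i : Fin n) :
    insLast x i.castSucc = x.1.succAbove (x.2 i) := by
  have := finSuccEquiv'_succAbove (Fin.last n) i
  rw [Fin.succAbove_last] at this
  simp [insLast, this]

theorem insLast_bij {n : ℕ} : Function.Bijective (@insLast n) := by
  rw [Fintype.bijective_iff_injective_and_card]
  constructor
  · rintro ⟨v, s⟩ ⟨w, t⟩ h
    have h1 : v = w := by
      have := congrArg (fun f : Equiv.Perm (Fin (n+1)) => f (Fin.last n)) h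
      simpa [insLast_last] using this
    subst h1
    have h2 : s = t := by
      ext i
      have := congrArg (fun f : Equiv.Perm (Fin (n+1)) => f i.castSucc) h
      simp only [insLast_castSucc] at this
      rw [Fin.succAbove_right_injective this]
    rw [h2]
  · simp [Fintype.card_perm, Nat.factorial_succ]

theorem isLtr_castSucc {n : ℕ} (x : Fin (n+1) × Equiv.Perm (Fin n)) (i : Fin n) :
    IsLtrMax (insLast x) i.castSucc ↔ IsLtrMax x.2 i := by
  unfold IsLtrMax
  constructor
  · intro h j hj
    have := h j.castSucc (by simpa using hj)
    rw [insLast_castSucc, insLast_castSucc] at this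
    simpa using this
  · intro h j
    induction j using Fin.lastCases with
    | last => 
      intro hj
      exact absurd hj (not_le.2 (Fin.castSucc_lt_last i))
    | cast j =>
      intro hj
      rw [insLast_castSucc, insLast_castSucc]
      simpa using h j (by simpa using hj)

theorem isLtr_last {n : ℕ} (x : Fin (n+1) × Equiv.Perm (Fin n)) :
    IsLtrMax (insLast x) (Fin.last n) ↔ x.1 = Fin.last n := by
  unfold IsLtrMax
  rw [insLast_last]
  constructor
  · intro h
    have := h ((insLast x).symm (Fin.last n)) (Fin.le_last _)
    simpa using this
  · intro h j _
    rw [h]; exact Fin.le_last _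

theorem count_insLast {n : ℕ} (x : Fin (n+1) × Equiv.Perm (Fin n)) :
    nonLtrMaxCount (insLast x) = nonLtrMaxCount x.2 + if x.1 = Fin.last n then 0 else 1 := by
  classical
  have e : ∀ (m : ℕ) (s : Equiv.Perm (Fin m)), nonLtrMaxCount s =
      ∑ i : Fin m, if IsLtrMax s i then 0 else 1 := by
    intro m s
    unfold nonLtrMaxCount
    rw [Set.ncard_eq_toFinset_card', Set.toFinset_ofPred, Finset.card_filter]
    exact Finset.sum_congr rfl (fun i _ => by by_cases h : IsLtrMax s i <;> simp [h])
  rw [e, e, Fin.sum_univ_castSucc]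
  simp only [isLtr_castSucc, isLtr_last]

theorem nl_le {n : ℕ} (s : Equiv.Perm (Fin n)) : nonLtrMaxCount s ≤ n := by
  unfold nonLtrMaxCount
  calc _ ≤ (Set.univ : Set (Fin n)).ncard := Set.ncard_le_ncard (Set.subset_univ _)
    _ = n := by simp [Set.ncard_univ]

theorem stir_zero : ∀ (n k : ℕ), n < k → stirling1 n k = 0
  | 0, 0, h => by omega
  | 0, k+1, _ => by simp [stirling1]
  | n+1, 0, h => by omega
  | n+1, k+1, h => by
    rw [stirling1, stir_zero n (k+1) (by omega), stir_zero n k (by omega)]; simp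

open Classical in
noncomputable def NN (n p : ℕ) : ℕ :=
  ∑ s : Equiv.Perm (Fin n), if nonLtrMaxCount s = p then 1 else 0

open Classical in
theorem NN_step (n p : ℕ) : NN (n+1) p =
    NN n p + n * ∑ s : Equiv.Perm (Fin n), if nonLtrMaxCount s + 1 = p then 1 else 0 := by
  unfold NN
  rw [← Function.Bijective.sum_comp (insLast_bij (n := n)), Fintype.sum_prod_type,
    Fin.sum_univ_castSucc]
  simp only [count_insLast]
  rw [add_comm]
  congr 1
  simp [Fin.ext_iff, fun i : Fin n => i.2.ne]

theorem NN_zero_of_lt (n p : ℕ) (h : n < p) : NN n p = 0 := by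
  unfold NN
  refine Finset.sum_eq_zero fun s _ => if_neg ?_
  have := nl_le s
  omega

theorem NN_eq : ∀ (n p : ℕ), p ≤ n → NN n p = stirling1 n (n - p)
  | 0, p, h => by
    obtain rfl : p = 0 := by omega
    have := fun s => nl_le (n := 0) s
    simp only [Nat.le_zero] at this
    simp [NN, this, stirling1]
  | n+1, 0, _ => by
    rw [NN_step, NN_eq n 0 (by omega)]
    simp [stirling1, stir_zero n (n+1)]
  | n+1, p+1, h => by
    rw [NN_step]
    have : (∑ s : Equiv.Perm (Fin n), if nonLtrMaxCount s + 1 = p + 1 then 1 else 0) = NN n p := by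
      simp [NN]
    rw [this, NN_eq n p (by omega)]
    rcases Nat.lt_or_ge p n with h1 | h1
    · rw [NN_eq n (p+1) (by omega)]
      obtain ⟨k, rfl⟩ : ∃ k, n = p + 1 + k := ⟨n - (p+1), by omega⟩
      rw [show p+1+k+1-(p+1) = k+1 by omega, show p+1+k-p = k+1 by omega,
        show p+1+k-(p+1) = k by omega, stirling1]
      ring
    · obtain rfl : p = n := by omega
      rw [NN_zero_of_lt _ _ (by omega)]
      cases p <;> simp [stirling1]

theorem part1 (n p : ℕ) (hp : p ≤ n) :
    Nat.card {σ : Equiv.Perm (Fin n) // nonLtrMaxCount σ = p} = stirling1 n (n - p) := by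
  classical
  rw [← NN_eq n p hp, Nat.card_eq_fintype_card, Fintype.card_subtype, Finset.card_filter]
  unfold NN
  exact Finset.sum_congr rfl fun _ _ => by congr

open Polynomial in
theorem antidiff (R : ℚ[X]) (d : ℕ) (hR : R.natDegree ≤ d) :
    ∃ Q : ℚ[X], Q.natDegree ≤ d + 1 ∧ Q.eval 0 = 0 ∧
      ∀ x : ℚ, Q.eval x - Q.eval (x - 1) = R.eval x := by
  have hb : ∀ k, (Polynomial.bernoulli k).natDegree ≤ k := by
    intro k
    rw [Polynomial.natDegree_le_iff_coeff_eq_zero]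
    intro N hN
    rw [Polynomial.coeff_bernoulli, if_neg (by omega)]
  let Q0 : ℚ[X] := ∑ k ∈ Finset.range (d+1),
    C (R.coeff k / (k+1)) * (Polynomial.bernoulli (k+1)).comp (1 + X)
  have hx : ∀ x : ℚ, Q0.eval x - Q0.eval (x - 1) = R.eval x := by
    intro x
    simp only [Q0, eval_finsetSum, eval_mul, eval_C, eval_comp, eval_add, eval_one, eval_X]
    rw [← Finset.sum_sub_distrib, eval_eq_sum_range' (Nat.lt_succ_of_le hR)]
    refine Finset.sum_congr rfl fun k _ => ?_
    rw [show 1 + (x - 1) = x by ring, bernoulli_eval_one_add]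
    have : (k : ℚ) + 1 ≠ 0 := by positivity
    push_cast
    field_simp
    simp
    ring
  have hd : Q0.natDegree ≤ d + 1 := by
    refine natDegree_sum_le_of_forall_le _ _ fun k hk => ?_
    refine (natDegree_C_mul_le _ _).trans ?_
    refine natDegree_comp_le.trans ?_
    have h1 := hb (k+1)
    have h2 : (1 + X : ℚ[X]).natDegree = 1 := by
      rw [add_comm]; exact natDegree_X_add_C (1:ℚ)
    rw [h2]
    have := Finset.mem_range.1 hk
    omega
  refine ⟨Q0 - C (Q0.eval 0), ?_, by simp, ?_⟩
  · rw [natDegree_sub_C]; exact hd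
  · intro x
    simpa using hx x

open Polynomial in
theorem stirPoly (p : ℕ) : ∃ P : ℚ[X], P.natDegree ≤ 2 * p ∧
    (∀ h : ℕ, P.eval (h : ℚ) = Nat.stirlingSecond (p + h) h) ∧
    (∀ n : ℕ, P.eval (-(n+1 : ℚ)) = if p ≤ n then (stirling1 (n+1) (n+1-p) : ℚ) else 0) := by
  induction p with
  | zero =>
    refine ⟨1, by simp, ?_, ?_⟩
    · intro h; simp [Nat.stirlingSecond_self]
    · intro n
      have : ∀ m, stirling1 m m = 1 := by
        intro m
        induction m with
        | zero => rfl
        | succ m ih => rw [stirling1, ih, stir_zero m (m+1) (by omega), mul_zero, zero_add]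
      simp [this]
  | succ p ih =>
    obtain ⟨P, hd, h1, h2⟩ := ih
    obtain ⟨Q, qd, q0, qx⟩ := antidiff (X * P) (2*p+1)
      (natDegree_mul_le.trans (by have := natDegree_X_le (R := ℚ); omega))
    simp only [eval_mul, eval_X] at qx
    refine ⟨Q, by omega, ?_, ?_⟩
    · intro h
      induction h with
      | zero => simpa using q0
      | succ h ih =>
        have := qx ((h+1 : ℕ) : ℚ)
        rw [h1, show ((h+1 : ℕ) : ℚ) - 1 = (h : ℚ) by push_cast; ring, ih] at this
        rw [show p + 1 + (h+1) = (p + 1 + h) + 1 by ring, Nat.stirlingSecond_succ_succ]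
        rw [show p + (h+1) = p + 1 + h by ring] at this
        push_cast at this ⊢
        linarith
    · intro n
      induction n with
      | zero =>
        have := qx 0
        simp only [q0, zero_mul] at this
        have h3 : Q.eval (-1 : ℚ) = 0 := by
          rw [zero_sub] at this; rw [zero_sub] at this; linarith
        simpa using h3
      | succ n ih =>
        have := qx (-(n+1 : ℚ))
        rw [ih, h2, show (-(n+1 : ℚ)) - 1 = -(((n+1:ℕ):ℚ)+1) by push_cast; ring] at this
        have e : Q.eval (-(((n+1:ℕ):ℚ)+1)) = (if p + 1 ≤ n then (stirling1 (n+1) (n+1-(p+1)) : ℚ) else 0)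
          + (n+1) * (if p ≤ n then (stirling1 (n+1) (n+1-p) : ℚ) else 0) := by linarith
        rw [e]
        rcases lt_trichotomy p n with h | h | h
        · rw [if_pos (by omega), if_pos (by omega), if_pos (by omega)]
          obtain ⟨k, rfl⟩ : ∃ k, n = p + 1 + k := ⟨n - (p+1), by omega⟩
          rw [show p+1+k+1+1-(p+1) = (k+1)+1 by omega, show p+1+k+1-p = k+1+1 by omega,
            show p+1+k+1-(p+1) = k+1 by omega, stirling1.eq_4 (p+1+k+1)]
          push_cast
          ring
        · subst h
          rw [if_neg (by omega), if_pos (by omega), if_pos (by omega)]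
          rw [show p+1+1-(p+1) = 0+1 by omega, show p+1-p = 0+1 by omega, stirling1.eq_4 (p+1) 0]
          simp [stirling1]
        · rw [if_neg (by omega), if_neg (by omega), if_neg (by omega)]
          simp

def FF (m h : ℕ) : ℚ := ∑ j ∈ Finset.range (h+1), (-1:ℚ)^j * (h.choose j) * ((h:ℚ) - j)^m

theorem FF_step (m h : ℕ) : FF (m+1) (h+1) = (h+1) * (FF m (h+1) + FF m h) := by
  have a : FF (m+1) (h+1) = (h+1) * ∑ j ∈ Finset.range (h+1),
      (-1:ℚ)^j * (h.choose j) * ((h:ℚ) + 1 - j)^m := by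
    unfold FF
    rw [Finset.sum_range_succ, Finset.mul_sum]
    simp only [Nat.cast_add, Nat.cast_one, sub_self, ne_eq, Nat.add_eq_zero_iff, one_ne_zero,
      and_false, not_false_eq_true, zero_pow, mul_zero, add_zero]
    refine Finset.sum_congr rfl fun j hj => ?_
    have hj' := Finset.mem_range.1 hj
    have := Nat.choose_mul_succ_eq h j
    have t : (h.choose j : ℚ) * (h+1) = ((h+1).choose j : ℚ) * ((h:ℚ)+1-j) := by
      have := congrArg (Nat.cast (R := ℚ)) this
      rw [Nat.cast_mul, Nat.cast_mul, Nat.cast_sub (by omega)] at this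
      push_cast at this
      exact this
    rw [pow_succ]
    linear_combination (-(-1:ℚ)^j * ((h:ℚ)+1-j)^m) * t
  have b : FF m (h+1) + FF m h = ∑ j ∈ Finset.range (h+1),
      (-1:ℚ)^j * (h.choose j) * ((h:ℚ) + 1 - j)^m := by
    unfold FF
    rw [Finset.sum_range_succ', Finset.sum_range_succ' (fun j => (-1:ℚ)^j * (h.choose j) * ((h:ℚ) + 1 - j)^m)]
    have : ∀ j, (-1:ℚ)^(j+1) * ((h+1).choose (j+1) : ℕ) * (((h+1:ℕ):ℚ) - ((j+1:ℕ):ℚ))^m =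
       (-1:ℚ)^(j+1) * (h.choose (j+1)) * ((h:ℚ) + 1 - ((j+1:ℕ):ℚ))^m
         - (-1:ℚ)^j * (h.choose j) * ((h:ℚ) - j)^m := by
      intro j
      rw [Nat.choose_succ_succ]
      push_cast
      rw [show (h:ℚ) + 1 - (j+1) = h - j by ring]
      ring
    rw [Finset.sum_congr rfl (fun j _ => this j), Finset.sum_sub_distrib,
      Finset.sum_range_succ (fun j => (-1:ℚ)^(j+1) * (h.choose (j+1)) * ((h:ℚ) + 1 - ((j+1:ℕ):ℚ))^m)]
    simp
    ring
  rw [a, b]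

theorem FF_eq : ∀ (m h : ℕ), FF m h = h.factorial * (Nat.stirlingSecond m h : ℚ)
  | 0, 0 => by simp [FF]
  | 0, h+1 => by
    have := Int.alternating_sum_range_choose_of_ne (n := h+1) (by omega)
    have := congrArg (Int.cast (R := ℚ)) this
    push_cast at this
    simpa [FF] using this
  | m+1, 0 => by simp [FF]
  | m+1, h+1 => by
    rw [FF_step, FF_eq m (h+1), FF_eq m h, Nat.stirlingSecond_succ_succ, Nat.factorial_succ]
    push_cast
    ring

theorem prod1 (a m : ℕ) : ∏ i ∈ Finset.range m, ((a:ℚ) + 1 + i) = ((a + m).choose m) * m.factorial := by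
  have := Nat.ascFactorial_eq_factorial_mul_choose a m
  have := congrArg (Nat.cast (R := ℚ)) this
  rw [Nat.ascFactorial_eq_prod_range] at this
  push_cast at this
  rw [this, mul_comm]

open Polynomial in
theorem basis_eval (n p h : ℕ) (hp : p ≤ n) (hh : h ≤ p) :
    (Lagrange.basis (Finset.range (2*p+1)) (fun i : ℕ => (i:ℚ) - p) (p+h)).eval (-(n+1:ℚ)) =
    (-1)^(p+h) * ((n+h).choose (p+h)) * ((n+1+p).choose (p-h)) := by
  obtain ⟨a, rfl⟩ := Nat.exists_eq_add_of_le hp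
  obtain ⟨t, rfl⟩ := Nat.exists_eq_add_of_le hh
  have hs : (Finset.range (2*(h+t)+1)).erase (h+t+h) =
      (Finset.range (h+t+h)) ∪ (Finset.range t).image (fun i => h+t+h+1+i) := by
    ext i
    simp only [Finset.mem_erase, Finset.mem_range, Finset.mem_union, Finset.mem_image]
    constructor
    · rintro ⟨h1, h2⟩
      rcases lt_or_gt_of_ne h1 with h3 | h3
      · exact Or.inl h3
      · exact Or.inr ⟨i - (h+t+h+1), by omega, by omega⟩
    · rintro (h1 | ⟨b, h1, rfl⟩) <;> omega
  rw [Lagrange.basis, eval_prod, hs, Finset.prod_union, Finset.prod_image]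
  rotate_left
  · intro x _ y _ hxy
    simpa using hxy
  · rw [Finset.disjoint_left]
    intro x hx hx'
    simp only [Finset.mem_range, Finset.mem_image] at hx hx'
    obtain ⟨b, _, rfl⟩ := hx'
    omega
  simp only [Lagrange.basisDivisor, eval_mul, eval_C, eval_sub, eval_X]
  have h1 : ∏ i ∈ Finset.range (h+t+h), ((((h+t+h:ℕ):ℚ) - ((h+t:ℕ):ℚ) - ((i:ℚ) - ((h+t:ℕ):ℚ)))⁻¹ *
      (-(((h+t+a:ℕ):ℚ)+1) - ((i:ℚ) - ((h+t:ℕ):ℚ)))) = (-1)^(h+t+h) * ((h+t+a+h).choose (h+t+h)) := by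
    have e1 : ∏ i ∈ Finset.range (h+t+h), (((h+t+h:ℕ):ℚ) - (i:ℚ)) = (h+t+h).factorial := by
      rw [← Finset.prod_range_reflect, ← Finset.prod_range_add_one_eq_factorial]
      push_cast
      refine Finset.prod_congr rfl fun i hi => ?_
      have := Finset.mem_range.1 hi
      rw [Nat.cast_sub (by omega), Nat.cast_sub (by omega)]
      push_cast
      ring
    have e2 : ∏ i ∈ Finset.range (h+t+h), (-(((h+t+a:ℕ):ℚ)+1) - ((i:ℚ) - ((h+t:ℕ):ℚ))) =
        (-1)^(h+t+h) * (((a + (h+t+h)).choose (h+t+h)) * (h+t+h).factorial) := by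
      rw [← prod1, ← Finset.card_range (h+t+h), ← Finset.prod_const, Finset.card_range,
        ← Finset.prod_mul_distrib]
      refine Finset.prod_congr rfl fun i hi => ?_
      push_cast
      ring
    rw [Finset.prod_mul_distrib, e2, Finset.prod_inv_distrib]
    simp only [sub_sub_sub_cancel_right]
    rw [e1, show h+t+a+h = a+(h+t+h) by ring]
    have : ((h+t+h).factorial : ℚ) ≠ 0 := by positivity
    field_simp
  have h2 : ∏ i ∈ Finset.range t, ((((h+t+h:ℕ):ℚ) - ((h+t:ℕ):ℚ) - (((h+t+h+1+i:ℕ):ℚ) - ((h+t:ℕ):ℚ)))⁻¹ *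
      (-(((h+t+a:ℕ):ℚ)+1) - (((h+t+h+1+i:ℕ):ℚ) - ((h+t:ℕ):ℚ)))) = ((h+t+a+1+(h+t)).choose t) := by
    have e1 := prod1 (h+t+a+1+h) t
    have e2 := prod1 0 t
    simp only [Nat.cast_zero, zero_add, Nat.choose_self, Nat.cast_one, one_mul] at e2
    have : ((t).factorial : ℚ) ≠ 0 := by positivity
    have e3 : ∀ i ∈ Finset.range t, ((((h+t+h:ℕ):ℚ) - ((h+t:ℕ):ℚ) - (((h+t+h+1+i:ℕ):ℚ) - ((h+t:ℕ):ℚ)))⁻¹ *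
      (-(((h+t+a:ℕ):ℚ)+1) - (((h+t+h+1+i:ℕ):ℚ) - ((h+t:ℕ):ℚ)))) =
      (((h+t+a+1+h:ℕ):ℚ)+1+i) / (1+i) := by
      intro i _
      have : (1:ℚ) + i ≠ 0 := by positivity
      push_cast
      rw [show ((h:ℚ) + t + h - (h+t) - (h+t+h+1+i-(h+t))) = -(1+i) by ring, inv_neg]
      field_simp
      ring
    rw [Finset.prod_congr rfl e3, Finset.prod_div_distrib, e1, e2,
      show h+t+a+1+h+t = h+t+a+1+(h+t) by ring]
    field_simp
  rw [show h + t - h = t by omega]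
  rw [h1, h2]

theorem part2 (n p : ℕ) (hp : p ≤ n) : (stirling1 (n+1) (n+1-p) : ℚ) =
      ∑ h ∈ Finset.range (p + 1), ∑ j ∈ Finset.range (h + 1),
        (-1 : ℚ) ^ j * (h.choose j) * ((n + h).choose (p + h)) *
          ((n + 1 + p).choose (p - h)) * ((j : ℚ) - (h : ℚ)) ^ (p + h) / (h.factorial : ℚ) := by
  obtain ⟨P, hd, h1, h2⟩ := stirPoly p
  have hP := Lagrange.eq_interpolate (s := Finset.range (2*p+1)) (v := fun i : ℕ => (i:ℚ) - p)
    (f := P) (by intro x _ y _ hxy; simpa using hxy)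
    (by
      rw [Finset.card_range]
      refine lt_of_le_of_lt Polynomial.degree_le_natDegree ?_
      exact_mod_cast Nat.lt_succ_of_le hd)
  have h3 := h2 n
  rw [if_pos hp] at h3
  rw [← h3]
  conv_lhs => rw [hP]
  rw [Lagrange.interpolate_apply, Polynomial.eval_finsetSum, show 2*p+1 = p + (p+1) by ring,
    Finset.sum_range_add, Finset.sum_eq_zero, zero_add, ← show 2*p+1 = p + (p+1) by ring]
  · refine Finset.sum_congr rfl fun h hh => ?_
    have hh' := Finset.mem_range.1 hh
    rw [Polynomial.eval_mul, Polynomial.eval_C, basis_eval n p h hp (by omega),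
      show ((p+h:ℕ):ℚ) - p = h by push_cast; ring, h1]
    have hf := FF_eq (p+h) h
    have hne : (h.factorial : ℚ) ≠ 0 := by positivity
    have : (Nat.stirlingSecond (p+h) h : ℚ) = FF (p+h) h / h.factorial := by
      rw [hf]; field_simp
    rw [this, FF, Finset.sum_div, Finset.sum_mul]
    refine Finset.sum_congr rfl fun j _ => ?_
    rw [← neg_sub (h:ℚ) j, neg_pow ((h:ℚ) - j)]
    ring
  · intro i hi
    have hi' := Finset.mem_range.1 hi
    rw [Polynomial.eval_mul, Polynomial.eval_C]
    have h4 := h2 (p - i - 1)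
    rw [if_neg (by omega)] at h4
    rw [show (i:ℚ) - p = -(((p-i-1:ℕ):ℚ)+1) by
      rw [Nat.cast_sub (by omega), Nat.cast_sub (by omega)]; push_cast; ring, h4, zero_mul]

/-- for `n ≥ 1` and `0 ≤ p ≤ n−1`, the number of permutations of length `n`
with exactly `p` non-left-to-right-maxima equals the signless Stirling number of the first
kind `s(n, n−p)`, given by Schlömilch's closed-form double sum. -/
theorem count_perms_with_p_nonLtrMax (n p : ℕ) (hn : 1 ≤ n) (hp : p ≤ n - 1) :
    Nat.card {σ : Equiv.Perm (Fin n) // nonLtrMaxCount σ = p} = stirling1 n (n - p) ∧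
    (stirling1 n (n - p) : ℚ) =
      ∑ h ∈ Finset.range (p + 1), ∑ j ∈ Finset.range (h + 1),
        (-1 : ℚ) ^ j * (h.choose j) * ((n - 1 + h).choose (p + h)) *
          ((n + p).choose (p - h)) * ((j : ℚ) - (h : ℚ)) ^ (p + h) / (h.factorial : ℚ) := by
  refine ⟨part1 n p (by omega), ?_⟩
  obtain ⟨m, rfl⟩ : ∃ m, n = m + 1 := ⟨n - 1, by omega⟩
  exact part2 m p (by omega)
end

section
/- For any two permutations σ and π of length n, the minimal number of right-jumps needed to transform σ into π equals the number of non-left-to-right-maxima of the permutation σ⁻¹∘π. In particular, the number of non-left-to-right-maxima of σ⁻¹ right-jumps are necessary and sufficient to sort σ into the identity permutation. -/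
theorem rj_nodup {n : ℕ} (α : Equiv.Perm (Fin n)) : (permWord α).Nodup := by
  unfold permWord
  exact List.nodup_ofFn.2 α.injective

theorem rj_mem {n : ℕ} (α : Equiv.Perm (Fin n)) (x : Fin n) : x ∈ permWord α := by
  unfold permWord
  rw [List.mem_ofFn]
  exact ⟨α⁻¹ x, by simp⟩

theorem rj_idx {n : ℕ} (α : Equiv.Perm (Fin n)) (x : Fin n) :
    (permWord α).idxOf x = (α⁻¹ x : Fin n).val := by
  have hl : (permWord α).length = n := by simp [permWord]
  have h := (rj_nodup α).idxOf_getElem (α⁻¹ x : Fin n).val (by rw [hl]; exact (α⁻¹ x).2)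
  have h2 : (permWord α)[(α⁻¹ x : Fin n).val]'(by rw [hl]; exact (α⁻¹ x).2) = x := by
    simp [permWord]
  rwa [h2] at h

theorem rj_lt {n : ℕ} (α : Equiv.Perm (Fin n)) (x y : Fin n) :
    α⁻¹ x < α⁻¹ y ↔ (permWord α).idxOf x < (permWord α).idxOf y := by
  rw [rj_idx, rj_idx, Fin.lt_def]

theorem rj_ofList {n : ℕ} (L : List (Fin n)) (h : L.Nodup) (hl : L.length = n) :
    ∃ γ : Equiv.Perm (Fin n), permWord γ = L := by
  subst_vars
  have hinj : Function.Injective (fun i : Fin n => L.get (Fin.cast hl.symm i)) := by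
    intro i j hij
    have := (List.nodup_iff_injective_get.1 h) hij
    simpa using this
  refine ⟨Equiv.ofBijective _ (Finite.injective_iff_bijective.1 hinj), ?_⟩
  unfold permWord
  apply List.ext_getElem
  · simp [hl]
  · intro i h1 h2
    simp

theorem rj_jump_order {n : ℕ} {α γ : Equiv.Perm (Fin n)} {l₁ l₂ l₃ : List (Fin n)} {a : Fin n}
    (h1 : permWord α = l₁ ++ a :: (l₂ ++ l₃))
    (h2 : permWord γ = l₁ ++ (l₂ ++ a :: l₃)) :
    (∀ x y, x ≠ a → α⁻¹ x < α⁻¹ y → γ⁻¹ x < γ⁻¹ y) ∧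
    (∀ x y, x ≠ a → y ≠ a → γ⁻¹ x < γ⁻¹ y → α⁻¹ x < α⁻¹ y) ∧
    (∀ x, x ∈ l₂ → α⁻¹ a < α⁻¹ x ∧ γ⁻¹ x < γ⁻¹ a) ∧
    (∀ x, α⁻¹ x < α⁻¹ a → γ⁻¹ x < γ⁻¹ a) ∧
    (∀ x, x ∈ l₃ → ∀ y ∈ l₂, α⁻¹ y < α⁻¹ x) ∧
    (∀ x, α⁻¹ a < α⁻¹ x → x ∈ l₂ ∨ x ∈ l₃) ∧
    (∀ x, γ⁻¹ x < γ⁻¹ a → x ∈ l₁ ∨ x ∈ l₂) := by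
  have nd := rj_nodup α
  rw [h1] at nd
  have A : ∀ x, x ∈ l₁ ++ a :: (l₂ ++ l₃) := fun x => h1 ▸ rj_mem α x
  have B1 : ∀ x, l₁.idxOf x < l₁.length ↔ x ∈ l₁ := fun x => List.idxOf_lt_length_iff
  have B2 : ∀ x, l₂.idxOf x < l₂.length ↔ x ∈ l₂ := fun x => List.idxOf_lt_length_iff
  simp only [rj_lt, h1, h2, List.idxOf_append, List.idxOf_cons]
  simp only [List.nodup_append, List.nodup_cons, List.mem_append, List.mem_cons] at nd A
  refine ⟨?_, ?_, ?_, ?_, ?_, ?_, ?_⟩ <;> grind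

def rjBad {n : ℕ} (α π : Equiv.Perm (Fin n)) : Set (Fin n) :=
  {b | ∃ c, π⁻¹ c < π⁻¹ b ∧ α⁻¹ b < α⁻¹ c}

theorem rj_count {n : ℕ} (α π : Equiv.Perm (Fin n)) :
    nonLtrMaxCount (α⁻¹ * π) = (rjBad α π).ncard := by
  have : rjBad α π = π '' {i | ¬ IsLtrMax (α⁻¹ * π) i} := by
    ext b
    simp only [rjBad, Set.mem_setOf_eq, Set.mem_image, IsLtrMax, not_forall, not_le]
    constructor
    · rintro ⟨c, h1, h2⟩
      exact ⟨π⁻¹ b, ⟨π⁻¹ c, h1.le, by simpa using h2⟩, by simp⟩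
    · rintro ⟨i, ⟨j, h1, h2⟩, rfl⟩
      refine ⟨π j, ?_, by simpa using h2⟩
      have : j ≠ i := by rintro rfl; simp at h2
      simpa using lt_of_le_of_ne h1 this
  rw [this, Set.ncard_image_of_injective _ π.injective]
  rfl

theorem rj_lower_step {n : ℕ} {α γ : Equiv.Perm (Fin n)} (π : Equiv.Perm (Fin n))
    (h : RightJump α γ) : (rjBad α π).ncard ≤ (rjBad γ π).ncard + 1 := by
  obtain ⟨l₁, l₂, l₃, a, -, h1, h2⟩ := h
  have H := (rj_jump_order h1 h2).1
  have hs : rjBad α π ⊆ insert a (rjBad γ π) := by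
    rintro b ⟨c, hc, hc'⟩
    by_cases hb : b = a
    · exact Or.inl hb
    · exact Or.inr ⟨c, hc, H b c hb hc'⟩
  exact (Set.ncard_le_ncard hs (Set.toFinite _)).trans (Set.ncard_insert_le _ _)

theorem rj_lower {n : ℕ} (π : Equiv.Perm (Fin n)) (q : ℕ) : ∀ α : Equiv.Perm (Fin n),
    ReachIn q α π → (rjBad α π).ncard ≤ q := by
  induction q with
  | zero =>
    intro α h
    have h : α = π := h
    subst h
    have : rjBad α α = ∅ := by
      ext b
      simp only [rjBad, Set.mem_setOf_eq, Set.mem_empty_iff_false, iff_false]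
      rintro ⟨c, h1, h2⟩
      exact lt_asymm h1 h2
    simp [this]
  | succ q ih =>
    rintro α ⟨γ, h1, h2⟩
    have := rj_lower_step π h1
    have := ih γ h2
    omega

theorem rj_upper_step {n : ℕ} (α π : Equiv.Perm (Fin n)) (a : Fin n) (ha : a ∈ rjBad α π) :
    ∃ γ, RightJump α γ ∧ rjBad γ π ⊆ rjBad α π \ {a} := by
  obtain ⟨c, ⟨hc1, hc2⟩, hmax⟩ : ∃ c, (π⁻¹ c < π⁻¹ a ∧ α⁻¹ a < α⁻¹ c) ∧
      ∀ d, π⁻¹ d < π⁻¹ a → α⁻¹ d ≤ α⁻¹ c := by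
    obtain ⟨c₀, h1, h2⟩ := ha
    obtain ⟨c, hc, hm⟩ := Set.exists_max_image {d | π⁻¹ d < π⁻¹ a} (fun d => α⁻¹ d)
      (Set.toFinite _) ⟨c₀, h1⟩
    exact ⟨c, ⟨hc, h2.trans_le (hm c₀ h1)⟩, fun d hd => hm d hd⟩
  obtain ⟨l₁, r, hr⟩ := List.append_of_mem (rj_mem α a)
  have hcr : c ∈ r := by
    have := (rj_jump_order (γ := α) (l₂ := []) (l₃ := r) (by simpa using hr)
      (by simpa using hr)).2.2.2.2.2.1 c hc2
    simpa using this
  obtain ⟨s, t, rfl⟩ := List.append_of_mem hcr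
  have hα : permWord α = l₁ ++ a :: ((s ++ [c]) ++ t) := by simpa using hr
  have hp : (l₁ ++ a :: ((s ++ [c]) ++ t)).Perm (l₁ ++ ((s ++ [c]) ++ a :: t)) :=
    List.Perm.append_left _ List.perm_middle.symm
  obtain ⟨γ, hγ⟩ := rj_ofList (l₁ ++ ((s ++ [c]) ++ a :: t))
    (hp.nodup_iff.1 (hα ▸ rj_nodup α))
    (by rw [← hp.length_eq, ← hα]; simp [permWord])
  obtain ⟨-, H2, H3, H4, H5, H6, H7⟩ := rj_jump_order hα hγ
  refine ⟨γ, ⟨l₁, s ++ [c], t, a, by simp, hα, hγ⟩, ?_⟩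
  have hct : ∀ x, x ∈ t → α⁻¹ c < α⁻¹ x := fun x hx => H5 x hx c (by simp)
  have hsc : ∀ x, x ∈ s ++ [c] → α⁻¹ x ≤ α⁻¹ c := by
    have nd := rj_nodup α
    rw [hr, ← List.cons_append, ← List.append_assoc] at nd
    have h' : permWord α = (l₁ ++ a :: s) ++ c :: ([] ++ t) := by simpa using hr
    obtain ⟨-, -, -, -, -, K6, -⟩ := rj_jump_order (γ := α) h' (by simpa using h')
    intro x hx
    by_contra hlt
    have := K6 x (not_le.1 hlt)
    simp only [List.nodup_append, List.nodup_cons, List.mem_append, List.mem_cons] at nd this hx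
    grind
  rintro b ⟨d, hd1, hd2⟩
  by_cases hb : b = a
  · exfalso
    subst hb
    have h1 := hmax d hd1
    have hne : d ≠ b := by rintro rfl; exact lt_irrefl _ hd1
    rcases lt_trichotomy (α⁻¹ d) (α⁻¹ b) with h | h | h
    · exact lt_asymm hd2 (H4 d h)
    · exact hne (α⁻¹.injective h)
    · rcases H6 d h with h | h
      · exact lt_asymm hd2 (H3 d h).2
      · exact absurd (hct d h) (not_lt.2 h1)
  · refine ⟨?_, hb⟩
    by_cases hd : d = a
    · subst hd
      rcases lt_trichotomy (α⁻¹ b) (α⁻¹ d) with h | h | h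
      · exact ⟨d, hd1, h⟩
      · exact absurd (α⁻¹.injective h) hb
      · have hbs : b ∈ s ++ [c] := by
          rcases H6 b h with h' | h'
          · exact h'
          · exfalso
            rcases H7 b hd2 with h'' | h''
            · have nd := rj_nodup α
              rw [hα] at nd
              simp only [List.nodup_append, List.mem_append, List.mem_cons] at nd
              grind
            · exact absurd (hsc b h'') (not_le.2 (hct b h'))
        refine ⟨c, hc1.trans hd1, lt_of_le_of_ne (hsc b hbs) ?_⟩
        intro he
        have := α⁻¹.injective he
        subst this
        exact lt_asymm hc1 hd1
    · exact ⟨d, hd1, H2 b d hb hd hd2⟩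

theorem rj_eq {n : ℕ} (α π : Equiv.Perm (Fin n)) (h : rjBad α π = ∅) : α = π := by
  have hm : StrictMono (fun i => α⁻¹ (π i)) := by
    intro i j hij
    by_contra hc
    have hne : α⁻¹ (π j) ≠ α⁻¹ (π i) := fun he =>
      hij.ne' (π.injective (α⁻¹.injective he))
    have : π j ∈ rjBad α π := ⟨π i, by simpa using hij, lt_of_le_of_ne (not_lt.1 hc) hne⟩
    rw [h] at this
    exact this
  have hid : (fun i => α⁻¹ (π i)) = id := by
    have hr : Set.range (fun i => α⁻¹ (π i)) = Set.range (id : Fin n → Fin n) := by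
      rw [Set.range_id]
      exact (α⁻¹.surjective.comp π.surjective).range_eq
    exact (hm.range_inj strictMono_id).1 hr
  ext i
  have := congrFun hid i
  simp only [id, Equiv.Perm.inv_eq_iff_eq] at this
  rw [this]

theorem rj_upper {n : ℕ} (π : Equiv.Perm (Fin n)) (q : ℕ) : ∀ α : Equiv.Perm (Fin n),
    (rjBad α π).ncard = q → ReachIn q α π := by
  induction q with
  | zero =>
    intro α h
    exact rj_eq α π ((Set.ncard_eq_zero (Set.toFinite _)).1 h)
  | succ q ih =>
    intro α h
    obtain ⟨a, ha⟩ : (rjBad α π).Nonempty := by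
      rw [← Set.ncard_pos (Set.toFinite _)]; omega
    obtain ⟨γ, hj, hs⟩ := rj_upper_step α π a ha
    refine ⟨γ, hj, ih γ ?_⟩
    have h1 := Set.ncard_le_ncard hs (Set.toFinite _)
    rw [Set.ncard_diff_singleton_of_mem ha] at h1
    have := rj_lower_step π hj
    omega

theorem rj_main {n : ℕ} (σ π : Equiv.Perm (Fin n)) :
    IsLeast {q : ℕ | ReachIn q σ π} (nonLtrMaxCount (σ⁻¹ * π)) := by
  rw [rj_count]
  exact ⟨rj_upper π _ σ rfl, fun q hq => rj_lower π q σ hq⟩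

/-- the minimal number of right-jumps needed to transform `σ` into `π` equals
the number of non-left-to-right-maxima of `σ⁻¹∘π`; in particular the number of
non-left-to-right-maxima of `σ⁻¹` right-jumps are necessary and sufficient to sort `σ`
into the identity. -/
theorem rightJump_distance (n : ℕ) (σ π : Equiv.Perm (Fin n)) :
    IsLeast {q : ℕ | ReachIn q σ π} (nonLtrMaxCount (σ⁻¹ * π)) ∧
    IsLeast {q : ℕ | ReachIn q σ 1} (nonLtrMaxCount σ⁻¹) := by
  exact ⟨rj_main σ π, by simpa using rj_main σ 1⟩
end

section
/- For every p ≥ 0, every permutation in the basis Bₚ has length at least p+2 and at most 2(p+1). Consequently, Bₚ is a finite set. -/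
/-- `π` is a pattern of `σ` (`π ≺ σ`): `σ` has a subsequence order-isomorphic to `π`. -/
def IsPattern {k n : ℕ} (π : Equiv.Perm (Fin k)) (σ : Equiv.Perm (Fin n)) : Prop :=
  ∃ f : Fin k → Fin n, StrictMono f ∧ ∀ i j : Fin k, π i < π j ↔ σ (f i) < σ (f j)

/-- `σ ∈ Cₚ` : `σ` is obtainable from the identity by at most `p` right-jumps. -/
def InC (p : ℕ) {n : ℕ} (σ : Equiv.Perm (Fin n)) : Prop :=
  ∃ q ≤ p, ReachIn q 1 σ

/-- `σ ∈ Bₚ`, the basis of `Cₚ`: `σ ∉ Cₚ` and every pattern `π ≺ σ` with `π ≠ σ`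
(equivalently, of length `≠ n`) belongs to `Cₚ`. -/
def InBasis (p : ℕ) {n : ℕ} (σ : Equiv.Perm (Fin n)) : Prop :=
  ¬ InC p σ ∧ ∀ (k : ℕ) (π : Equiv.Perm (Fin k)), IsPattern π σ → k ≠ n → InC p π

/-- `b_{n,p}`: the number of basis permutations of length `n` in `Bₚ`. -/
noncomputable def bnp (n p : ℕ) : ℕ :=
  Nat.card {σ : Equiv.Perm (Fin n) // InBasis p σ}

def PNL {n : ℕ} (l : List (Fin n)) (a : Fin n) : Prop :=
  ∃ b, a < b ∧ [b, a].Sublist l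

theorem pair_sub_ofFn {n : ℕ} (f : Fin n → Fin n) (a b : Fin n) :
    [b, a].Sublist (List.ofFn f) ↔ ∃ j i, j < i ∧ f j = b ∧ f i = a := by
  constructor
  · intro h
    by_contra hc
    have : (List.ofFn f).Pairwise (fun x y => ¬ (x = b ∧ y = a)) := by
      rw [List.pairwise_ofFn]
      intro j i hji hh
      exact hc ⟨j, i, hji, hh⟩
    rw [List.pairwise_iff_forall_sublist] at this
    exact this h ⟨rfl, rfl⟩
  · rintro ⟨j, i, hji, rfl, rfl⟩
    have : (List.ofFn f).Pairwise (fun x y => [x, y].Sublist (List.ofFn f)) := by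
      rw [List.pairwise_iff_forall_sublist]
      intro a b h
      exact h
    rw [List.pairwise_ofFn] at this
    exact this hji

theorem not_ltr_iff {n : ℕ} (σ : Equiv.Perm (Fin n)) (i : Fin n) :
    ¬ IsLtrMax σ i ↔ PNL (permWord σ) (σ i) := by
  unfold IsLtrMax PNL permWord
  simp only [pair_sub_ofFn]
  push Not
  constructor
  · rintro ⟨j, hj, h⟩
    refine ⟨σ j, h, j, i, lt_of_le_of_ne hj ?_, rfl, rfl⟩
    rintro rfl
    exact lt_irrefl _ h
  · rintro ⟨b, hb, j, i', hji, rfl, h⟩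
    have := σ.injective h
    subst this
    exact ⟨j, hji.le, hb⟩

theorem count_eq {n : ℕ} (σ : Equiv.Perm (Fin n)) :
    nonLtrMaxCount σ = {a | PNL (permWord σ) a}.ncard := by
  unfold nonLtrMaxCount
  have : {a | PNL (permWord σ) a} = σ '' {i | ¬ IsLtrMax σ i} := by
    ext a
    simp only [Set.mem_image, Set.mem_ofPred_eq, not_ltr_iff]
    constructor
    · intro h
      exact ⟨σ.symm a, by simpa using h, by simp⟩
    · rintro ⟨i, h, rfl⟩
      exact h
  rw [this, Set.ncard_image_of_injective _ σ.injective]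

theorem pair_append {α : Type*} (a b : α) (s t : List α) :
    [a, b].Sublist (s ++ t) ↔ [a, b].Sublist s ∨ (a ∈ s ∧ b ∈ t) ∨ [a, b].Sublist t := by
  rw [List.sublist_append_iff]
  constructor
  · rintro ⟨l₁, l₂, h, h1, h2⟩
    match l₁, h, h1 with
    | [], h, h1 => simp at h; subst h; exact Or.inr (Or.inr h2)
    | [x], h, h1 =>
      simp at h
      obtain ⟨rfl, rfl⟩ := h
      simp at h1 h2
      exact Or.inr (Or.inl ⟨h1, h2⟩)
    | [x, y], h, h1 =>
      simp at h
      obtain ⟨rfl, rfl, rfl⟩ := h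
      exact Or.inl h1
    | x :: y :: z :: w, h, h1 => simp at h
  · rintro (h | ⟨h1, h2⟩ | h)
    · exact ⟨[a, b], [], by simp, h, by simp⟩
    · exact ⟨[a], [b], by simp, by simpa, by simpa⟩
    · exact ⟨[], [a, b], by simp, by simp, h⟩

theorem pair_cons {α : Type*} (a b c : α) (t : List α) :
    [a, b].Sublist (c :: t) ↔ (a = c ∧ b ∈ t) ∨ [a, b].Sublist t := by
  have := pair_append a b [c] t
  rw [List.singleton_append] at this
  rw [this]
  have h : ¬ [a, b].Sublist [c] := fun h => by simpa using h.length_le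
  simp [h]

theorem jump_count {n : ℕ} (α β : Equiv.Perm (Fin n)) (h : RightJump α β) :
    nonLtrMaxCount β ≤ nonLtrMaxCount α + 1 := by
  obtain ⟨l₁, l₂, l₃, a, -, hα, hβ⟩ := h
  rw [count_eq, count_eq]
  refine le_trans (Set.ncard_le_ncard (t := insert a {a | PNL (permWord α) a}) ?_
    (Set.toFinite _)) (Set.ncard_insert_le _ _)
  rintro x ⟨b, hb, hs⟩
  by_cases hx : x = a
  · exact Or.inl hx
  · refine Or.inr ⟨b, hb, ?_⟩
    rw [hα]
    rw [hβ] at hs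
    simp only [pair_append, pair_cons, List.mem_append, List.mem_cons] at hs ⊢
    tauto

theorem reach_count {n : ℕ} (q : ℕ) (α β : Equiv.Perm (Fin n)) (h : ReachIn q α β) :
    nonLtrMaxCount β ≤ nonLtrMaxCount α + q := by
  induction q generalizing α with
  | zero => simp only [ReachIn] at h; subst h; simp
  | succ q ih =>
    obtain ⟨γ, h1, h2⟩ := h
    have := ih _ h2
    have := jump_count _ _ h1
    omega

theorem count_one {n : ℕ} : nonLtrMaxCount (1 : Equiv.Perm (Fin n)) = 0 := by
  unfold nonLtrMaxCount
  simp [IsLtrMax]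

theorem inC_count {n p : ℕ} (σ : Equiv.Perm (Fin n)) (h : InC p σ) :
    nonLtrMaxCount σ ≤ p := by
  obtain ⟨q, hq, h⟩ := h
  have := reach_count _ _ _ h
  rw [count_one] at this
  omega

theorem reach_snoc {n : ℕ} (q : ℕ) (α γ β : Equiv.Perm (Fin n)) (h : ReachIn q α γ)
    (h' : RightJump γ β) : ReachIn (q + 1) α β := by
  induction q generalizing α with
  | zero => simp only [ReachIn] at h; subst h; exact ⟨β, h', rfl⟩
  | succ q ih =>
    obtain ⟨δ, h1, h2⟩ := h
    exact ⟨δ, h1, ih _ h2⟩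

theorem exists_word {n : ℕ} (l : List (Fin n)) (hl : l.Nodup) (hn : l.length = n) :
    ∃ γ : Equiv.Perm (Fin n), permWord γ = l := by
  have hinj : Function.Injective (fun i : Fin n => l.get (i.cast hn.symm)) := by
    intro i j h
    have := (List.nodup_iff_injective_get.1 hl) h
    simpa using this
  refine ⟨Equiv.ofBijective _ (Finite.injective_iff_bijective.1 hinj), ?_⟩
  unfold permWord
  apply List.ext_get
  · simp [hn]
  · intro k h1 h2
    simp

theorem exists_back {n : ℕ} (σ : Equiv.Perm (Fin n)) (h : nonLtrMaxCount σ ≠ 0) :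
    ∃ γ, RightJump γ σ ∧ nonLtrMaxCount γ < nonLtrMaxCount σ := by
  rw [count_eq] at h
  obtain ⟨a, b, hab, hs⟩ := Set.nonempty_of_ncard_ne_zero h
  have hnd : (permWord σ).Nodup := List.nodup_ofFn.2 σ.injective
  have hlen : (permWord σ).length = n := by simp [permWord]
  obtain ⟨s, l₃, hw⟩ := List.append_of_mem (hs.subset (by simp : a ∈ [b, a]))
  have hnd' := hnd
  rw [hw, List.nodup_append] at hnd'
  simp only [List.nodup_cons] at hnd'
  obtain ⟨hsn, ⟨ha3, h3n⟩, hdis⟩ := hnd'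
  have has : a ∉ s := fun h => hdis a h a (by simp) rfl
  have hbs : b ∈ s := by
    rw [hw] at hs
    simp only [pair_append, pair_cons, List.mem_cons] at hs
    rcases hs with h | h | h
    · exact absurd (h.subset (by simp)) has
    · exact h.1
    · rcases h with h | h
      · exact absurd h.2 ha3
      · exact absurd (h.subset (by simp)) ha3
  obtain ⟨l₁, h₀, l₂, hsd, hl1, hh⟩ : ∃ l₁ h₀ l₂, s = l₁ ++ h₀ :: l₂ ∧ (∀ x ∈ l₁, x < a) ∧
      ¬ h₀ < a := by
    have h1 := List.takeWhile_append_dropWhile (p := fun x => decide (x < a)) (l := s)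
    have h2 : s.dropWhile (fun x => decide (x < a)) ≠ [] := by
      intro h
      rw [List.dropWhile_eq_nil_iff] at h
      have := h b hbs
      simp at this
      exact absurd this (not_lt.2 hab.le)
    obtain ⟨y, t, hy⟩ := List.exists_cons_of_ne_nil h2
    refine ⟨_, y, t, by rw [← hy]; exact h1.symm, ?_, ?_⟩
    · intro x hx
      simpa using List.mem_takeWhile_imp hx
    · have := List.head_dropWhile_not (fun x => decide (x < a)) h2
      simpa [hy] using this
  subst hsd
  have hperm : (l₁ ++ a :: ((h₀ :: l₂) ++ l₃)).Perm (permWord σ) := by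
    rw [hw, List.append_assoc]
    exact List.Perm.append_left _ List.perm_middle.symm
  obtain ⟨γ, hγ⟩ := exists_word _ (hperm.nodup_iff.2 hnd) (hperm.length_eq.trans hlen)
  refine ⟨γ, ⟨l₁, h₀ :: l₂, l₃, a, by simp, hγ, by rw [hw, List.append_assoc]⟩, ?_⟩
  rw [count_eq, count_eq]
  apply Set.ncard_lt_ncard _ (Set.toFinite _)
  rw [Set.ssubset_iff_of_subset]
  · refine ⟨a, ⟨b, hab, hs⟩, ?_⟩
    rintro ⟨c, hc, hcs⟩
    rw [hγ] at hcs
    simp only [List.mem_append, List.mem_cons, not_or] at has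
    simp only [pair_append, pair_cons, List.mem_append, List.mem_cons, List.cons_append] at hcs
    have hx : ∀ {t : List (Fin n)}, [c, a].Sublist t → a ∈ t := fun h => h.subset (by simp)
    have hc1 : c ∈ l₁ := by
      have e1 := @hx l₁
      have e2 := @hx l₂
      have e3 := @hx l₃
      tauto
    exact absurd (hl1 c hc1) (not_lt.2 hc.le)
  · rintro x ⟨c, hc, hcs⟩
    rw [hγ] at hcs
    by_cases hx2 : c = a ∧ x ∈ h₀ :: l₂
    · obtain ⟨rfl, hx2⟩ := hx2
      have hxh : x < h₀ := lt_of_lt_of_le hc (not_lt.1 hh)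
      refine ⟨h₀, hxh, ?_⟩
      have : x ∈ l₂ := by
        rcases List.mem_cons.1 hx2 with h | h
        · exact absurd h hxh.ne
        · exact h
      rw [hw]
      simp only [pair_append, pair_cons]
      tauto
    · refine ⟨c, hc, ?_⟩
      rw [hw]
      by_cases hxa : x = a
      · subst hxa
        simp only [List.mem_append, List.mem_cons, not_or] at has
        simp only [pair_append, pair_cons, List.mem_append, List.mem_cons,
          List.cons_append] at hcs ⊢
        have hx : ∀ {t : List (Fin n)}, [c, x].Sublist t → x ∈ t := fun h => h.subset (by simp)
        have e1 := @hx l₁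
        have e2 := @hx l₂
        have e3 := @hx l₃
        tauto
      · simp only [pair_append, pair_cons, List.mem_append, List.mem_cons,
          List.cons_append] at hcs hx2 ⊢
        grind

theorem count_inC {n p : ℕ} (σ : Equiv.Perm (Fin n)) (h : nonLtrMaxCount σ ≤ p) : InC p σ := by
  induction p generalizing σ with
  | zero =>
    refine ⟨0, le_rfl, ?_⟩
    have h0 : nonLtrMaxCount σ = 0 := by omega
    unfold nonLtrMaxCount at h0
    rw [Set.ncard_eq_zero] at h0
    have hm : Monotone σ := by
      intro j i hji
      by_contra hc
      have : i ∈ {i : Fin n | ¬ IsLtrMax σ i} := fun hh => hc (hh j hji)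
      rw [h0] at this
      exact this
    have hs : StrictMono σ := hm.strictMono_of_injective σ.injective
    have := (hs.range_inj strictMono_id).1 (by simp [σ.surjective.range_eq])
    show 1 = σ
    ext i
    simp [this]
  | succ p ih =>
    by_cases h0 : nonLtrMaxCount σ = 0
    · obtain ⟨q, hq, hr⟩ := ih σ (by omega)
      exact ⟨q, by omega, hr⟩
    · obtain ⟨γ, hj, hlt⟩ := exists_back σ h0
      obtain ⟨q, hq, hr⟩ := ih γ (by omega)
      exact ⟨q + 1, by omega, reach_snoc _ _ _ _ hr hj⟩

theorem exists_pattern {n : ℕ} (σ : Equiv.Perm (Fin n)) (S : Finset (Fin n)) :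
    ∃ (π : Equiv.Perm (Fin S.card)),
      ∀ i j, π i < π j ↔ σ (S.orderEmbOfFin rfl i) < σ (S.orderEmbOfFin rfl j) := by
  let T := S.map σ.toEmbedding
  have hT : T.card = S.card := Finset.card_map _
  let g := T.orderIsoOfFin hT
  let F : Fin S.card → Fin S.card := fun i => g.symm ⟨σ (S.orderEmbOfFin rfl i), by
    simp [T]⟩
  have hF : ∀ i j, F i < F j ↔ σ (S.orderEmbOfFin rfl i) < σ (S.orderEmbOfFin rfl j) := by
    intro i j
    simp only [F, OrderIso.lt_iff_lt, Subtype.mk_lt_mk]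
  have hinj : Function.Injective F := by
    intro i j h
    have h1 := g.symm.injective h
    simp only [Subtype.mk.injEq] at h1
    exact (S.orderEmbOfFin rfl).injective (σ.injective h1)
  exact ⟨Equiv.ofBijective F (Finite.injective_iff_bijective.1 hinj), hF⟩

theorem basis_upper {n p : ℕ} (σ : Equiv.Perm (Fin n)) (h : InBasis p σ) :
    n ≤ 2 * (p + 1) := by
  classical
  obtain ⟨h1, h2⟩ := h
  have hc : p + 1 ≤ nonLtrMaxCount σ := by
    by_contra hc
    exact h1 (count_inC σ (by omega))
  obtain ⟨A, hA, hAc⟩ := Set.exists_subset_card_eq hc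
  have hw : ∀ i : Fin n, ∃ j, i ∈ A → j < i ∧ σ i < σ j := by
    intro i
    by_cases hi : i ∈ A
    · have := hA hi
      simp only [Set.mem_ofPred_eq, IsLtrMax] at this
      push Not at this
      obtain ⟨j, hj, hlt⟩ := this
      refine ⟨j, fun _ => ⟨lt_of_le_of_ne hj ?_, hlt⟩⟩
      rintro rfl
      exact lt_irrefl _ hlt
    · exact ⟨i, fun h => absurd h hi⟩
  choose w hw using hw
  let A' : Finset (Fin n) := A.toFinset
  have hA'c : A'.card = p + 1 := by
    rw [← hAc, Set.ncard_eq_toFinset_card']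
  let S := A' ∪ A'.image w
  have hS : S.card ≤ 2 * (p + 1) := by
    have := Finset.card_union_le A' (A'.image w)
    have := Finset.card_image_le (s := A') (f := w)
    show (A' ∪ A'.image w).card ≤ _
    omega
  obtain ⟨π, hπ⟩ := exists_pattern σ S
  by_contra hlt
  have hin := h2 _ π ⟨_, (S.orderEmbOfFin rfl).strictMono, hπ⟩ (by omega)
  have hle := inC_count π hin
  have hsub : A ⊆ (S.orderEmbOfFin rfl) '' {i | ¬ IsLtrMax π i} := by
    intro i hi
    have hiA : i ∈ A' := by simpa [A'] using hi
    have hiS : i ∈ S := Finset.mem_union_left _ hiA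
    have hwS : w i ∈ S := Finset.mem_union_right _ (Finset.mem_image_of_mem _ hiA)
    have hr := Finset.range_orderEmbOfFin S rfl
    obtain ⟨i', hi'⟩ : i ∈ Set.range (S.orderEmbOfFin rfl) := by rw [hr]; exact hiS
    obtain ⟨j', hj'⟩ : w i ∈ Set.range (S.orderEmbOfFin rfl) := by rw [hr]; exact hwS
    refine ⟨i', ?_, hi'⟩
    intro hl
    obtain ⟨e1, e2⟩ := hw i hi
    rw [← hj', ← hi'] at e1
    have e3 := hl j' ((S.orderEmbOfFin rfl).lt_iff_lt.1 e1).le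
    have e4 : π i' < π j' := by rw [hπ, hj', hi']; exact e2
    exact absurd e4 (not_lt.2 e3)
  have h5 := Set.ncard_le_ncard hsub (Set.toFinite _)
  rw [Set.ncard_image_of_injective _ (S.orderEmbOfFin rfl).injective, hAc] at h5
  unfold nonLtrMaxCount at hle
  omega

theorem basis_lower {n p : ℕ} (σ : Equiv.Perm (Fin n)) (h : InBasis p σ) :
    p + 2 ≤ n := by
  have hc : p + 1 ≤ nonLtrMaxCount σ := by
    by_contra hc
    exact h.1 (count_inC σ (by omega))
  unfold nonLtrMaxCount at hc
  match n, σ, hc with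
  | 0, σ, hc =>
    have : {i : Fin 0 | ¬ IsLtrMax σ i} = ∅ := Set.eq_empty_of_isEmpty _
    rw [this] at hc
    simp at hc
  | n + 1, σ, hc =>
    have hss : {i : Fin (n + 1) | ¬ IsLtrMax σ i} ⊂ Set.univ := by
      rw [Set.ssubset_univ_iff]
      intro he
      have : (0 : Fin (n + 1)) ∈ {i : Fin (n + 1) | ¬ IsLtrMax σ i} := by rw [he]; trivial
      apply this
      intro j hj
      rw [Fin.le_zero_iff.1 hj]
    have := Set.ncard_lt_ncard hss (Set.toFinite _)
    rw [Set.ncard_univ, Nat.card_eq_fintype_card, Fintype.card_fin] at this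
    omega

/-- every permutation in the basis `Bₚ` has length at least `p+2` and at most
`2(p+1)`; consequently `Bₚ` is a finite set. -/
theorem basis_length_bounds (p : ℕ) :
    (∀ (n : ℕ) (σ : Equiv.Perm (Fin n)), InBasis p σ → p + 2 ≤ n ∧ n ≤ 2 * (p + 1)) ∧
    {x : Σ n : ℕ, Equiv.Perm (Fin n) | InBasis p x.2}.Finite := by
  refine ⟨fun n σ h => ⟨basis_lower σ h, basis_upper σ h⟩, ?_⟩
  refine Set.Finite.subset (Set.Finite.biUnion (Set.finite_Iic (2 * (p + 1)))
    (t := fun n => Set.range (Sigma.mk (β := fun n => Equiv.Perm (Fin n)) n))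
    (fun n _ => Set.finite_range _)) ?_
  rintro ⟨n, σ⟩ h
  simp only [Set.mem_iUnion]
  exact ⟨n, basis_upper σ h, σ, rfl⟩
end

section
/- For every real number x with |x| < 1, the series Σ_{n≥0} bₙ xⁿ/n! converges and equals ((√5 − 1)/(2√5))·(1−x)^{(1+√5)/2} + ((√5 + 1)/(2√5))·(1−x)^{(1−√5)/2} − 1. -/
/-- The sequence `bₙ` (number of basis permutations of length `n`), defined by
`b₀ = b₁ = 0`, `b₂ = 1`, and `b_{n+2} = 2n·b_{n+1} + (1+n−n²)·bₙ` for `n ≥ 1`. -/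
def bseq : ℕ → ℤ
  | 0 => 0
  | 1 => 0
  | 2 => 1
  | n + 3 =>
      2 * ((n : ℤ) + 1) * bseq (n + 2) +
        (1 + ((n : ℤ) + 1) - ((n : ℤ) + 1) ^ 2) * bseq (n + 1)

noncomputable def eaux (a : ℝ) (n : ℕ) : ℝ := ∏ i ∈ Finset.range n, ((i : ℝ) - a)

lemma eaux_succ (a : ℝ) (n : ℕ) : eaux a (n+1) = eaux a n * (n - a) := by
  simp [eaux, Finset.prod_range_succ]

lemma eaux_rec (a : ℝ) (ha : a ^ 2 = a + 1) (n : ℕ) :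
    eaux a (n+2) = 2 * n * eaux a (n+1) + (1 + n - n^2) * eaux a n := by
  rw [eaux_succ, eaux_succ]; push_cast
  linear_combination (eaux a n) * ha

lemma eaux_choose (a : ℝ) (n : ℕ) : Ring.choose a n * (n.factorial : ℝ) = (-1)^n * eaux a n := by
  have h := Ring.descPochhammer_eq_factorial_smul_choose a n
  rw [nsmul_eq_mul, mul_comm] at h
  rw [← h]
  clear h
  induction n with
  | zero => simp [eaux]
  | succ n ih =>
    rw [descPochhammer_succ_right, Polynomial.smeval_mul, ih, eaux_succ,
      Polynomial.smeval_sub, Polynomial.smeval_X, Polynomial.smeval_natCast]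
    simp only [pow_zero, pow_one, nsmul_eq_mul, mul_one]
    ring

lemma eaux_hasSum (a x : ℝ) (hx : |x| < 1) :
    HasSum (fun n : ℕ => eaux a n * x ^ n / (n.factorial : ℝ)) ((1 - x) ^ a) := by
  have h := (Real.one_add_rpow_hasFPowerSeriesOnBall_zero (a := a)).hasSum (y := -x)
    (by simpa [enorm_eq_nnnorm, ← NNReal.coe_lt_coe] using hx)
  simp only [binomialSeries_apply] at h
  have e : (fun n : ℕ => eaux a n * x ^ n / (n.factorial : ℝ)) =
      fun n => Ring.choose a n • (List.ofFn fun _ : Fin n => -x).prod := by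
    funext n
    have := eaux_choose a n
    have hf : (n.factorial : ℝ) ≠ 0 := by positivity
    have h1 : Ring.choose a n = (-1)^n * eaux a n / n.factorial := by
      rw [← this]; field_simp
    have h2 : ((-1:ℝ)^n) * (-1)^n = 1 := by rw [← mul_pow]; simp
    simp only [h1, List.prod_ofFn, Finset.prod_const, Finset.card_univ, Fintype.card_fin,
      smul_eq_mul]
    rw [neg_pow x]
    linear_combination (-(eaux a n * x ^ n / n.factorial)) * h2
  rw [e, show 1 - x = 1 + (0 + -x) by ring]
  exact h

lemma bseq_eaux (s : ℝ) (hs : s ^ 2 = 5) (h0 : s ≠ 0) (n : ℕ) :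
    (bseq (n+1) : ℝ) = (s - 1) / (2 * s) * eaux ((1 + s) / 2) (n+1)
      + (s + 1) / (2 * s) * eaux ((1 - s) / 2) (n+1) ∧
    (bseq (n+2) : ℝ) = (s - 1) / (2 * s) * eaux ((1 + s) / 2) (n+2)
      + (s + 1) / (2 * s) * eaux ((1 - s) / 2) (n+2) := by
  have ha : ((1 + s) / 2) ^ 2 = (1 + s) / 2 + 1 := by linear_combination hs / 4
  have hb : ((1 - s) / 2) ^ 2 = (1 - s) / 2 + 1 := by linear_combination hs / 4
  induction n with
  | zero =>
    constructor
    · simp [bseq, eaux]; field_simp; ring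
    · rw [eaux_rec _ ha, eaux_rec _ hb]
      simp [bseq, eaux]; field_simp; ring
  | succ n ih =>
    refine ⟨ih.2, ?_⟩
    rw [eaux_rec _ ha, eaux_rec _ hb]
    have : bseq (n+1+2) = 2 * ((n : ℤ) + 1) * bseq (n + 2) +
        (1 + ((n : ℤ) + 1) - ((n : ℤ) + 1) ^ 2) * bseq (n + 1) := by
      rw [show n+1+2 = n+3 from rfl, bseq]
    rw [this]; push_cast
    rw [ih.1, ih.2]
    ring

/-- for every real `x` with `|x| < 1`, the series `Σ bₙ xⁿ/n!` converges and
equals `((√5−1)/(2√5))·(1−x)^{(1+√5)/2} + ((√5+1)/(2√5))·(1−x)^{(1−√5)/2} − 1`. -/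
theorem egf_closed_form (x : ℝ) (hx : |x| < 1) :
    HasSum (fun n : ℕ => (bseq n : ℝ) * x ^ n / (n.factorial : ℝ))
      ((Real.sqrt 5 - 1) / (2 * Real.sqrt 5) * (1 - x) ^ ((1 + Real.sqrt 5) / 2) +
        (Real.sqrt 5 + 1) / (2 * Real.sqrt 5) * (1 - x) ^ ((1 - Real.sqrt 5) / 2) - 1) := by
  have hs : Real.sqrt 5 ^ 2 = 5 := Real.sq_sqrt (by norm_num)
  have h0 : Real.sqrt 5 ≠ 0 := by positivity
  have h := (((eaux_hasSum ((1 + Real.sqrt 5) / 2) x hx).mul_left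
    ((Real.sqrt 5 - 1) / (2 * Real.sqrt 5))).add
    ((eaux_hasSum ((1 - Real.sqrt 5) / 2) x hx).mul_left
    ((Real.sqrt 5 + 1) / (2 * Real.sqrt 5)))).sub (hasSum_ite_eq (0:ℕ) (1:ℝ))
  refine (congrArg (fun f : ℕ → ℝ => HasSum f _) ?_).mpr h
  funext n
  cases n with
  | zero => simp [bseq, eaux]; field_simp; ring
  | succ n =>
    rw [(bseq_eaux _ hs h0 n).1]
    simp
    ring
end
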